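/- Let n ≥ 5 be an integer, p > (n+4)/(n−4), and set K = K₀^{1/(p−1)}. Let s₀ ∈ ℝ and let z₁, z₂, z₃, z₄ : (−∞, s₀] → ℝ be continuously differentiable functions satisfying the system z₁' = (4/(p−1))z₁ + z₂, z₂' = (4/(p−1)+2)z₂ + z₃, z₃' = (4/(p−1)−(n−2))z₃ + z₄, z₄' = |z₁+K|^{p−1}(z₁+K) − K^p + (4/(p−1)−(n−4))z₄ on (−∞, s₀]. If z₁(s₀) > 0, z₂(s₀) < 0, z₃(s₀) > 0 and z₄(s₀) < 0, then for every s ≤ s₀ one has z₁(s) > 0, z₂(s) < 0, z₃(s) > 0 and z₄(s) < 0. In particular, the function v(s) := z₁(s) + K satisfies v(s) > K for all s ≤ s₀, so the corresponding radial function u(r) := r^{−4/(p−1)} v(log r) satisfies u(r) > u_s(r) for all 0 < r ≤ e^{s₀} and is unbounded as r → 0. -/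

import Mathlib

/-- Backward continuous induction on `(-∞, b]`. -/
theorem forall_le_of_backward_induction {P : ℝ → Prop} {b : ℝ} (hb : P b)
    (hstep : ∀ t < b, (∀ s, t < s → s ≤ b → P s) → P t)
    (hopen : ∀ t ≤ b, P t → ∀ᶠ s in nhds t, P s) : ∀ s ≤ b, P s := by
  by_contra! hcon
  obtain ⟨x, hxb, hx⟩ := hcon
  let S : Set ℝ := {s | s ≤ b ∧ ¬ P s}
  have hSne : S.Nonempty := ⟨x, hxb, hx⟩
  have hSbdd : BddAbove S := ⟨b, fun s hs => hs.1⟩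
  have htb : sSup S ≤ b := csSup_le hSne fun s hs => hs.1
  have hright : ∀ s, sSup S < s → s ≤ b → P s := by
    intro s hs hsb
    by_contra hn
    exact absurd (le_csSup hSbdd (show s ∈ S from ⟨hsb, hn⟩)) (not_le.2 hs)
  have hPt : P (sSup S) := by
    rcases htb.lt_or_eq with h | h
    · exact hstep _ h hright
    · rwa [h]
  obtain ⟨ε, hε, hball⟩ := Metric.eventually_nhds_iff.1 (hopen _ htb hPt)
  obtain ⟨s, hsS, hs⟩ := exists_lt_of_lt_csSup hSne (sub_lt_self (sSup S) hε)
  refine hsS.2 (hball ?_)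
  have := le_csSup hSbdd hsS
  rw [Real.dist_eq, abs_lt]
  constructor <;> linarith

/-- A solution of `f' = c f + g` with `g < 0` that is positive at `b` is positive at
every earlier time `t`. -/
theorem pos_of_hasDerivAt_linear_of_neg {f g : ℝ → ℝ} {c t b : ℝ} (htb : t < b)
    (hf : ∀ s, t ≤ s → s ≤ b → HasDerivAt f (c * f s + g s) s)
    (hg : ∀ s, t < s → s ≤ b → g s < 0) (hb : 0 < f b) : 0 < f t := by
  have hd : ∀ s, t ≤ s → s ≤ b →
      HasDerivAt (fun s => Real.exp (-c * s) * f s) (Real.exp (-c * s) * g s) s := by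
    intro s hs hsb
    have he : HasDerivAt (fun s : ℝ => Real.exp (-c * s)) (Real.exp (-c * s) * (-c)) s := by
      simpa using ((hasDerivAt_id s).const_mul (-c)).exp
    exact (he.mul (hf s hs hsb)).congr_deriv (by ring)
  have hanti : StrictAntiOn (fun s => Real.exp (-c * s) * f s) (Set.Icc t b) := by
    refine strictAntiOn_of_deriv_neg (convex_Icc t b)
      (fun s hs => (hd s hs.1 hs.2).continuousAt.continuousWithinAt) fun s hs => ?_
    rw [interior_Icc] at hs
    rw [(hd s hs.1.le hs.2.le).deriv]
    exact mul_neg_of_pos_of_neg (Real.exp_pos _) (hg s hs.1 hs.2.le)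
  have hlt := hanti (Set.left_mem_Icc.2 htb.le) (Set.right_mem_Icc.2 htb.le) htb
  exact pos_of_mul_pos_right ((mul_pos (Real.exp_pos _) hb).trans hlt) (Real.exp_pos _).le

/-- A solution of `f' = c f + g` with `g > 0` that is negative at `b` is negative at
every earlier time `t`. -/
theorem neg_of_hasDerivAt_linear_of_pos {f g : ℝ → ℝ} {c t b : ℝ} (htb : t < b)
    (hf : ∀ s, t ≤ s → s ≤ b → HasDerivAt f (c * f s + g s) s)
    (hg : ∀ s, t < s → s ≤ b → 0 < g s) (hb : f b < 0) : f t < 0 := by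
  have h := pos_of_hasDerivAt_linear_of_neg (f := fun s => -f s) (g := fun s => -g s) (c := c)
    htb (fun s hs hsb => (hf s hs hsb).neg.congr_deriv (by ring))
    (fun s hs hsb => neg_lt_zero.2 (hg s hs hsb)) (neg_pos.2 hb)
  exact neg_pos.1 h

/-- The nonlinearity `|v|^(p-1) v` exceeds its value at `K` to the right of `K`. -/
theorem abs_rpow_mul_sub_rpow_pos {p K z : ℝ} (hp : 1 < p) (hK : 0 < K) (hz : 0 < z) :
    0 < |z + K| ^ (p - 1) * (z + K) - K ^ p := by
  have hzK : 0 < z + K := add_pos hz hK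
  have hpow : (z + K) ^ (p - 1) * (z + K) = (z + K) ^ p := by
    rw [← Real.rpow_add_one hzK.ne', sub_add_cancel]
  rw [abs_of_pos hzK, hpow, sub_pos]
  exact Real.rpow_lt_rpow hK.le (by linarith) (by linarith)


/-- for the shifted autonomous system associated with
`Δ²u = |u|^{p−1}u` around the equilibrium `K = K₀^{1/(p−1)}`, if at some time
`s₀` one has the sign pattern `z₁ > 0, z₂ < 0, z₃ > 0, z₄ < 0`, then this sign
pattern persists for all `s ≤ s₀`; in particular `v = z₁ + K > K` on
`(−∞, s₀]`, so the corresponding radial function `u(r) = r^{−4/(p−1)} v(log r)`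
lies above the singular solution on `(0, e^{s₀}]` and is unbounded as `r → 0`. -/
theorem statement1 (n : ℕ) (hn : 5 ≤ n) (p : ℝ)
    (hp : ((n : ℝ) + 4) / ((n : ℝ) - 4) < p)
    (K : ℝ)
    (hK : K = ((4 / (p - 1)) * (4 / (p - 1) + 2) * ((n : ℝ) - 2 - 4 / (p - 1))
      * ((n : ℝ) - 4 - 4 / (p - 1))) ^ (1 / (p - 1)))
    (s₀ : ℝ) (z₁ z₂ z₃ z₄ : ℝ → ℝ)
    (h1 : ∀ s ≤ s₀, HasDerivAt z₁ (4 / (p - 1) * z₁ s + z₂ s) s)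
    (h2 : ∀ s ≤ s₀, HasDerivAt z₂ ((4 / (p - 1) + 2) * z₂ s + z₃ s) s)
    (h3 : ∀ s ≤ s₀, HasDerivAt z₃ ((4 / (p - 1) - ((n : ℝ) - 2)) * z₃ s + z₄ s) s)
    (h4 : ∀ s ≤ s₀, HasDerivAt z₄
      (|z₁ s + K| ^ (p - 1) * (z₁ s + K) - K ^ p
        + (4 / (p - 1) - ((n : ℝ) - 4)) * z₄ s) s)
    (hz1 : 0 < z₁ s₀) (hz2 : z₂ s₀ < 0) (hz3 : 0 < z₃ s₀) (hz4 : z₄ s₀ < 0) :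
    (∀ s ≤ s₀, 0 < z₁ s ∧ z₂ s < 0 ∧ 0 < z₃ s ∧ z₄ s < 0) ∧
    (∀ s ≤ s₀, K < z₁ s + K) ∧
    (∀ r : ℝ, 0 < r → r ≤ Real.exp s₀ →
      ((4 / (p - 1)) * (4 / (p - 1) + 2) * ((n : ℝ) - 2 - 4 / (p - 1))
          * ((n : ℝ) - 4 - 4 / (p - 1))) ^ (1 / (p - 1)) * r ^ (-(4 / (p - 1)))
        < r ^ (-(4 / (p - 1))) * (z₁ (Real.log r) + K)) ∧
    (∀ M : ℝ, ∃ r : ℝ, 0 < r ∧ r ≤ Real.exp s₀ ∧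
      M < r ^ (-(4 / (p - 1))) * (z₁ (Real.log r) + K)) := by
  have hn' : (5 : ℝ) ≤ n := by exact_mod_cast hn
  have hn4 : (0 : ℝ) < n - 4 := by linarith
  have hp8 : 8 < (p - 1) * ((n : ℝ) - 4) := by
    rw [div_lt_iff₀ hn4] at hp
    linarith
  have hp1 : 0 < p - 1 := by
    by_contra! h
    nlinarith
  have ha : 0 < 4 / (p - 1) := by positivity
  have ha4 : 4 / (p - 1) < (n : ℝ) - 4 := by
    rw [div_lt_iff₀ hp1]
    linarith
  have hKpos : 0 < K := by
    rw [hK]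
    have h2 : 0 < (n : ℝ) - 2 - 4 / (p - 1) := by linarith
    have h4 : 0 < (n : ℝ) - 4 - 4 / (p - 1) := by linarith
    positivity
  rw [← hK]
  have hsigns : ∀ s ≤ s₀, 0 < z₁ s ∧ z₂ s < 0 ∧ 0 < z₃ s ∧ z₄ s < 0 := by
    refine forall_le_of_backward_induction ⟨hz1, hz2, hz3, hz4⟩ (fun t ht hP => ?_)
      fun t ht hP => ?_
    · exact ⟨pos_of_hasDerivAt_linear_of_neg ht (fun s _ hs => h1 s hs)
          (fun s hts hs => (hP s hts hs).2.1) hz1,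
        neg_of_hasDerivAt_linear_of_pos ht (fun s _ hs => h2 s hs)
          (fun s hts hs => (hP s hts hs).2.2.1) hz2,
        pos_of_hasDerivAt_linear_of_neg ht (fun s _ hs => h3 s hs)
          (fun s hts hs => (hP s hts hs).2.2.2) hz3,
        neg_of_hasDerivAt_linear_of_pos ht
          (fun s _ hs => (h4 s hs).congr_deriv (add_comm _ _))
          (fun s hts hs => abs_rpow_mul_sub_rpow_pos (by linarith) hKpos (hP s hts hs).1) hz4⟩
    · filter_upwards [(h1 t ht).continuousAt.eventually (lt_mem_nhds hP.1),
        (h2 t ht).continuousAt.eventually (gt_mem_nhds hP.2.1),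
        (h3 t ht).continuousAt.eventually (lt_mem_nhds hP.2.2.1),
        (h4 t ht).continuousAt.eventually (gt_mem_nhds hP.2.2.2)] with s e1 e2 e3 e4
      exact ⟨e1, e2, e3, e4⟩
  have habove : ∀ s ≤ s₀, K < z₁ s + K := fun s hs => by linarith [(hsigns s hs).1]
  refine ⟨hsigns, habove, fun r hr hrs => ?_, fun M => ?_⟩
  · rw [mul_comm K]
    exact mul_lt_mul_of_pos_left (habove _ ((Real.log_le_iff_le_exp hr).2 hrs))
      (Real.rpow_pos_of_pos hr _)
  · obtain ⟨m, hms, hmM⟩ : ∃ m ≤ s₀, m ≤ -(M / (4 / (p - 1) * K)) :=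
      ⟨min s₀ (-(M / (4 / (p - 1) * K))), min_le_left _ _, min_le_right _ _⟩
    refine ⟨Real.exp m, Real.exp_pos m, Real.exp_le_exp.2 hms, ?_⟩
    rw [← Real.exp_mul, Real.log_exp]
    calc M ≤ m * -(4 / (p - 1)) * K := by
          have h := (div_le_iff₀ (mul_pos ha hKpos)).1 (le_neg_of_le_neg hmM)
          linarith
      _ ≤ Real.exp (m * -(4 / (p - 1))) * K := by
          gcongr
          linarith [Real.add_one_le_exp (m * -(4 / (p - 1)))]
      _ < Real.exp (m * -(4 / (p - 1))) * (z₁ m + K) :=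
          mul_lt_mul_of_pos_left (habove m hms) (Real.exp_pos _)
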